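/- Let n > 2 and (8 - n)/3 < α < 2. There exists ε > 0 such that for every q with 2 ≤ q ≤ 2n/(n-1) + 2ε there is a constant K > 0 such that for all φ ∈ C_c^∞(B ∖ {0}): ∫_B d^α λ^{-n} (div(λ^{n-2} ∇φ))² dx ≥ ((n - α)²/4) ∫_B d^{α-2} |∇φ|² λ^{n-2} dx + K ( ∫_B d^{((n-2)(q-2) + (α-2)q)/2} |φ|^q dx )^{2/q}, where the last integral is with respect to Lebesgue measure dx (no λ factor). -/

import Mathlib

open MeasureTheory

/-- Conformal factor of the Poincaré ball model. -/
noncomputable def lam {n : ℕ} (x : EuclideanSpace ℝ (Fin n)) : ℝ := 2 / (1 - ‖x‖ ^ 2)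

/-- Hyperbolic distance to the origin in the Poincaré ball model. -/
noncomputable def dH {n : ℕ} (x : EuclideanSpace ℝ (Fin n)) : ℝ :=
  Real.log ((1 + ‖x‖) / (1 - ‖x‖))

/-- Euclidean divergence of a vector field on ℝⁿ. -/
noncomputable def dvg {n : ℕ} (V : EuclideanSpace ℝ (Fin n) → EuclideanSpace ℝ (Fin n))
    (x : EuclideanSpace ℝ (Fin n)) : ℝ :=
  ∑ i, fderiv ℝ V x (EuclideanSpace.single i 1) i

section Divergence

variable {n : ℕ}

local notation "𝔼" => EuclideanSpace ℝ (Fin n)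

lemma sum_apply_single_mul (L : 𝔼 →L[ℝ] ℝ) (v : 𝔼) :
    ∑ i, L (EuclideanSpace.single i 1) * v i = L v := by
  conv_rhs => rw [← (EuclideanSpace.basisFun (Fin n) ℝ).sum_repr v]
  simp [map_sum, mul_comm]

lemma dvg_smul {s : 𝔼 → ℝ} {V : 𝔼 → 𝔼} {x : 𝔼} (hs : DifferentiableAt ℝ s x)
    (hV : DifferentiableAt ℝ V x) :
    dvg (fun y => s y • V y) x = fderiv ℝ s x (V x) + s x * dvg V x := by
  unfold dvg
  rw [fderiv_fun_smul hs hV, ← sum_apply_single_mul (fderiv ℝ s x) (V x), Finset.mul_sum,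
    ← Finset.sum_add_distrib]
  exact Finset.sum_congr rfl fun i _ => by simp [add_comm]

lemma dvg_add {U V : 𝔼 → 𝔼} {x : 𝔼} (hU : DifferentiableAt ℝ U x)
    (hV : DifferentiableAt ℝ V x) :
    dvg (fun y => U y + V y) x = dvg U x + dvg V x := by
  unfold dvg
  rw [fderiv_fun_add hU hV, ← Finset.sum_add_distrib]
  rfl

lemma dvg_id (x : 𝔼) : dvg (fun y => y) x = n := by
  simp [dvg]

lemma dvg_smul_id {s : 𝔼 → ℝ} {x : 𝔼} (hs : DifferentiableAt ℝ s x) :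
    dvg (fun y => s y • y) x = fderiv ℝ s x x + n * s x := by
  rw [dvg_smul hs differentiableAt_fun_id, dvg_id, mul_comm]

lemma dvg_eq_zero_of_notMem_tsupport {V : 𝔼 → 𝔼} {x : 𝔼} (hx : x ∉ tsupport V) :
    dvg V x = 0 := by
  have : fderiv ℝ V x = 0 := by
    have := (tsupport_fderiv_subset ℝ (f := V))
    exact image_eq_zero_of_notMem_tsupport fun h => hx (this h)
  simp [dvg, this]

lemma continuous_dvg {V : 𝔼 → 𝔼} (hV : ContDiff ℝ 1 V) : Continuous (dvg V) := by
  have := hV.continuous_fderiv one_ne_zero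
  unfold dvg
  fun_prop

lemma integral_dvg_eq_zero {V : 𝔼 → 𝔼} (hV : ContDiff ℝ 1 V) (hc : HasCompactSupport V) :
    ∫ x, dvg V x = 0 := by
  have hV' := hV.continuous_fderiv one_ne_zero
  have hd := hV.differentiable one_ne_zero
  have key : ∀ i : Fin n,
      Integrable (fun x => fderiv ℝ V x (EuclideanSpace.single i 1) i) ∧
      ∫ x, fderiv ℝ V x (EuclideanSpace.single i 1) i = 0 := by
    intro i
    have hc1 : HasCompactSupport fun x => fderiv ℝ V x (EuclideanSpace.single i 1) i :=
      (hc.fderiv ℝ).mono fun x hx h => hx (by simp [h])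
    have hint : Integrable (fun x => fderiv ℝ V x (EuclideanSpace.single i 1) i) :=
      Continuous.integrable_of_hasCompactSupport (by fun_prop) hc1
    refine ⟨hint, ?_⟩
    have hfd : ∀ x, fderiv ℝ (fun y => V y i) x (EuclideanSpace.single i 1)
        = fderiv ℝ V x (EuclideanSpace.single i 1) i := fun x => by
      have := ((EuclideanSpace.proj (𝕜 := ℝ) i).hasFDerivAt.comp x (hd x).hasFDerivAt).fderiv
      change fderiv ℝ (fun y => V y i) x = _ at this
      rw [this]; rfl
    have hVi : Integrable (fun x => V x i) :=
      Continuous.integrable_of_hasCompactSupport (by have := hV.continuous; fun_prop)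
        (hc.mono fun x hx h => hx (by simp [h]))
    have := integral_mul_fderiv_eq_neg_fderiv_mul_of_integrable (𝕜 := ℝ) (μ := volume)
      (f := fun _ : 𝔼 => (1 : ℝ)) (g := fun y => V y i) (v := EuclideanSpace.single i 1)
      (by simp) (by simpa [hfd] using hint) (by simpa using hVi)
      (fun x _ => by fun_prop) (fun x _ => by have := hd x; fun_prop)
    simpa [hfd] using this
  unfold dvg
  rw [integral_finsetSum _ fun i _ => (key i).1]
  exact Finset.sum_eq_zero fun i _ => (key i).2

/-- The divergence of a compactly supported `C¹` field integrates to zero over any set containing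
its support. -/
lemma setIntegral_dvg_eq_zero {V : 𝔼 → 𝔼} {s : Set 𝔼} (hV : ContDiff ℝ 1 V)
    (hc : HasCompactSupport V) (hs : tsupport V ⊆ s) : ∫ x in s, dvg V x = 0 := by
  rw [setIntegral_eq_integral_of_forall_compl_eq_zero fun x hx =>
    dvg_eq_zero_of_notMem_tsupport fun h => hx (hs h)]
  exact integral_dvg_eq_zero hV hc

lemma integrable_of_continuousOn_of_eq_zero {f : 𝔼 → ℝ} {K : Set 𝔼} (hK : IsCompact K)
    (hf : ContinuousOn f K) (h0 : ∀ x ∉ K, f x = 0) : Integrable f :=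
  (integrableOn_iff_integrable_of_support_subset
    fun x hx => by_contra fun h => hx (h0 x h)).1 (hf.integrableOn_compact hK)

lemma hasFDerivAt_comp_norm {F : ℝ → ℝ} {F' : ℝ} {x : 𝔼} (hx : x ≠ 0)
    (hF : HasDerivAt F F' ‖x‖) :
    HasFDerivAt (fun y : 𝔼 => F ‖y‖) ((F' / ‖x‖) • innerSL ℝ x) x := by
  have h1 : HasFDerivAt (fun y : 𝔼 => ‖y‖) (‖x‖⁻¹ • innerSL ℝ x) x := by
    have h2 := ((hasStrictFDerivAt_norm_sq x).hasFDerivAt.sqrt (by simpa using hx))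
    simp only [Real.sqrt_sq (norm_nonneg _)] at h2
    refine h2.congr_fderiv ?_
    have hr : ‖x‖ ≠ 0 := norm_ne_zero_iff.2 hx
    ext v
    simp
    field_simp
  refine (hF.comp_hasFDerivAt x h1).congr_fderiv ?_
  rw [smul_smul, div_eq_mul_inv]

lemma contDiff_gradient {φ : 𝔼 → ℝ} (hφ : ContDiff ℝ (⊤ : ℕ∞) φ) :
    ContDiff ℝ (⊤ : ℕ∞) (gradient φ) := by
  have : ContDiff ℝ (⊤ : ℕ∞) (fderiv ℝ φ) := hφ.fderiv_right (by simp)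
  exact (InnerProductSpace.toDual ℝ 𝔼).symm.contDiff.comp this

lemma inner_gradient {φ : 𝔼 → ℝ} (x v : 𝔼) : inner ℝ (gradient φ x) v = fderiv ℝ φ x v := by
  rw [← toDual_gradient]; rfl

lemma inner_fderiv_gradient_comm {φ : 𝔼 → ℝ} (hφ : ContDiff ℝ (⊤ : ℕ∞) φ) (x v w : 𝔼) :
    inner ℝ (fderiv ℝ (gradient φ) x v) w = inner ℝ (fderiv ℝ (gradient φ) x w) v := by
  have h1 : ContDiff ℝ (⊤ : ℕ∞) (fderiv ℝ φ) := hφ.fderiv_right (by simp)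
  have h2 : ∀ v w, inner ℝ (fderiv ℝ (gradient φ) x v) w = fderiv ℝ (fderiv ℝ φ) x v w := by
    intro v w
    have h3 := ((InnerProductSpace.toDual ℝ 𝔼).symm.toContinuousLinearEquiv.hasFDerivAt.comp x
      (h1.differentiable (by simp) x).hasFDerivAt).fderiv
    change fderiv ℝ (gradient φ) x = _ at h3
    rw [h3]
    exact InnerProductSpace.toDual_symm_apply
  have hs : IsSymmSndFDerivAt ℝ φ x :=
    hφ.contDiffAt.isSymmSndFDerivAt (by
      rw [minSmoothness_of_isRCLikeNormedField]
      exact WithTop.coe_le_coe.2 (le_top : (2 : ℕ∞) ≤ ⊤))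
  rw [h2, h2, hs]

lemma gradient_eq_zero_of_notMem_tsupport {φ : 𝔼 → ℝ} {x : 𝔼} (hx : x ∉ tsupport φ) :
    gradient φ x = 0 := by
  have : fderiv ℝ φ x = 0 :=
    image_eq_zero_of_notMem_tsupport fun h => hx (tsupport_fderiv_subset ℝ h)
  simp [gradient, this]

lemma contDiff_of_contDiffAt_tsupport {F : Type*} [NormedAddCommGroup F] [NormedSpace ℝ F]
    {f : 𝔼 → F} (h : ∀ x ∈ tsupport f, ContDiffAt ℝ 1 f x) : ContDiff ℝ 1 f := by
  refine contDiff_iff_contDiffAt.2 fun x => ?_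
  by_cases hx : x ∈ tsupport f
  · exact h x hx
  · exact (contDiffAt_const (c := (0 : F))).congr_of_eventuallyEq
      (notMem_tsupport_iff_eventuallyEq.1 hx)

end Divergence

section PointwiseIdentity

variable {n : ℕ}

local notation "𝔼" => EuclideanSpace ℝ (Fin n)

/-- Divergence of the vector field used to integrate the Rellich quotient by parts, for radial
profiles `g`, `p`, `m`, `k`. The second derivatives of `φ` only enter through the divergence of
`m ∇φ`. -/
lemma dvg_radial_field {φ : 𝔼 → ℝ} (hφ : ContDiff ℝ (⊤ : ℕ∞) φ) {x : 𝔼} (hx : x ≠ 0)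
    {g p m k : ℝ → ℝ} {g' p' m' k' : ℝ} (hg : HasDerivAt g g' ‖x‖) (hp : HasDerivAt p p' ‖x‖)
    (hm : HasDerivAt m m' ‖x‖) (hk : HasDerivAt k k' ‖x‖) :
    dvg (fun y => (g ‖y‖ * inner ℝ y (gradient φ y) + p ‖y‖ * φ y) • (m ‖y‖ • gradient φ y) +
        (k ‖y‖ * φ y ^ 2 - g ‖y‖ * m ‖y‖ * (1 / 2) * ‖gradient φ y‖ ^ 2) • y) x =
      (g ‖x‖ * inner ℝ x (gradient φ x) + p ‖x‖ * φ x) *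
          dvg (fun y => m ‖y‖ • gradient φ y) x +
        m ‖x‖ * (g' / ‖x‖ * inner ℝ x (gradient φ x) ^ 2 + g ‖x‖ * ‖gradient φ x‖ ^ 2 +
          p' / ‖x‖ * φ x * inner ℝ x (gradient φ x) + p ‖x‖ * ‖gradient φ x‖ ^ 2) +
        (k' * ‖x‖ * φ x ^ 2 + 2 * k ‖x‖ * φ x * inner ℝ x (gradient φ x) + n * k ‖x‖ * φ x ^ 2) -
        ((g' * m ‖x‖ + g ‖x‖ * m') * ‖x‖ / 2 + n * (g ‖x‖ * m ‖x‖ / 2)) *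
          ‖gradient φ x‖ ^ 2 := by
  have hr : ‖x‖ ≠ 0 := norm_ne_zero_iff.2 hx
  have hG : HasFDerivAt (gradient φ) (fderiv ℝ (gradient φ) x) x :=
    ((contDiff_gradient hφ).differentiable (by simp) x).hasFDerivAt
  have hf : HasFDerivAt φ (fderiv ℝ φ x) x := (hφ.differentiable (by simp) x).hasFDerivAt
  have hg1 := hasFDerivAt_comp_norm hx hg
  have hp1 := hasFDerivAt_comp_norm hx hp
  have hm1 := hasFDerivAt_comp_norm hx hm
  have hk1 := hasFDerivAt_comp_norm hx hk
  have hE : HasFDerivAt (fun y => inner ℝ y (gradient φ y)) _ x := (hasFDerivAt_id x).inner ℝ hG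
  have hA : HasFDerivAt (fun y => g ‖y‖ * inner ℝ y (gradient φ y) + p ‖y‖ * φ y) _ x :=
    (hg1.mul hE).add (hp1.mul hf)
  have hB : HasFDerivAt
      (fun y => k ‖y‖ * φ y ^ 2 - g ‖y‖ * m ‖y‖ * (1 / 2) * ‖gradient φ y‖ ^ 2) _ x :=
    (hk1.mul (hf.pow 2)).sub (((hg1.mul hm1).mul_const (1 / 2)).mul hG.norm_sq)
  have hV : HasFDerivAt (fun y => m ‖y‖ • gradient φ y) _ x := hm1.smul hG
  have hfx : fderiv ℝ φ x x = inner ℝ x (gradient φ x) := by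
    rw [← inner_gradient, real_inner_comm]
  have hfG : fderiv ℝ φ x (gradient φ x) = ‖gradient φ x‖ ^ 2 := by
    rw [← inner_gradient, real_inner_self_eq_norm_sq]
  have hBx : fderiv ℝ (fun y => k ‖y‖ * φ y ^ 2 - g ‖y‖ * m ‖y‖ * (1 / 2) * ‖gradient φ y‖ ^ 2) x
      x =
      k' * ‖x‖ * φ x ^ 2 + 2 * k ‖x‖ * φ x * inner ℝ x (gradient φ x) -
      ((g' * m ‖x‖ + g ‖x‖ * m') * ‖x‖ / 2 * ‖gradient φ x‖ ^ 2 +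
        g ‖x‖ * m ‖x‖ * inner ℝ x (fderiv ℝ (gradient φ) x (gradient φ x))) := by
    have h2 : inner ℝ (gradient φ x) (fderiv ℝ (gradient φ) x x) =
        inner ℝ x (fderiv ℝ (gradient φ) x (gradient φ x)) := by
      rw [real_inner_comm, inner_fderiv_gradient_comm hφ, real_inner_comm]
    rw [hB.fderiv]
    simp only [sub_apply, add_apply, smul_apply,
      ContinuousLinearMap.comp_apply, innerSL_apply_apply, smul_eq_mul, nsmul_eq_mul, hfx, h2,
      real_inner_self_eq_norm_sq, Pi.mul_apply]
    field_simp
    ring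
  have hAG : fderiv ℝ (fun y => g ‖y‖ * inner ℝ y (gradient φ y) + p ‖y‖ * φ y) x
      (gradient φ x) = g' / ‖x‖ * inner ℝ x (gradient φ x) ^ 2 + g ‖x‖ * ‖gradient φ x‖ ^ 2 +
          p' / ‖x‖ * φ x * inner ℝ x (gradient φ x) + p ‖x‖ * ‖gradient φ x‖ ^ 2 +
          g ‖x‖ * inner ℝ x (fderiv ℝ (gradient φ) x (gradient φ x)) := by
    rw [hA.fderiv]
    simp [hfG]
    ring
  rw [dvg_add (hA.differentiableAt.fun_smul hV.differentiableAt)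
      (hB.differentiableAt.fun_smul differentiableAt_fun_id),
    dvg_smul hA.differentiableAt hV.differentiableAt, dvg_smul_id hB.differentiableAt, hBx,
    map_smul, hAG, smul_eq_mul]
  ring

lemma rellich_algebra {ν α a c κ d r l M P v T u D h : ℝ} (hν : 3 ≤ ν) (hα : α < 2)
    (ha : a = (ν + α - 4) / 2) (hc : c = (ν - α) / 2) (ha0 : 0 < a)
    (hκ₁ : κ ≤ a ^ 2) (hκ₂ : κ ≤ 2 * c * a - c ^ 2) (hd : 0 < d) (hr : 0 < r) (hr1 : r < 1)
    (hl : l = 2 / (1 - r ^ 2)) (hM : 0 < M) (hP : 0 < P) (hT : 0 ≤ T)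
    (hh : h = d * ((1 + r ^ 2) / (2 * r)) - 1) (hh0 : 0 ≤ h) :
    c ^ 2 * (P * d ^ 2 * M * (l ^ 2 * (v ^ 2 + T))) +
      κ * (P * d ^ 2 * M * (l ^ 2 * (T + (v + a * u / d) ^ 2))) +
      ((2 * (2 - α) * (P * d ^ 3 / (r * l)) * (r * l * v) + -2 * a ^ 2 * (P * d ^ 2) * u) * D +
        M * (2 * (2 - α) * (P * ((α - 1) * d ^ 2 / r - d ^ 3 - d ^ 3 / (l * r ^ 2))) / r *
            (r * l * v) ^ 2 +
          2 * (2 - α) * (P * d ^ 3 / (r * l)) * (l ^ 2 * (v ^ 2 + T)) +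
          -2 * a ^ 2 * ((α - 2) * (P * d) * l) / r * u * (r * l * v) +
          -2 * a ^ 2 * (P * d ^ 2) * (l ^ 2 * (v ^ 2 + T))) +
        (-a ^ 3 * (M * P * ((α - 3) * l ^ 2 / r + (ν - 1) * d * l ^ 2 - d * l / r ^ 2)) * r * u ^ 2 +
          2 * (-a ^ 3 * (P * d * M * l / r)) * u * (r * l * v) +
          ν * (-a ^ 3 * (P * d * M * l / r)) * u ^ 2) -
        ((2 * (2 - α) * (P * ((α - 1) * d ^ 2 / r - d ^ 3 - d ^ 3 / (l * r ^ 2))) * M +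
          2 * (2 - α) * (P * d ^ 3 / (r * l)) * ((ν - 2) * M * r * l)) * r / 2 +
          ν * (2 * (2 - α) * (P * d ^ 3 / (r * l)) * M / 2)) * (l ^ 2 * (v ^ 2 + T))) ≤
      P * d ^ 4 * (M * l ^ 2)⁻¹ * D ^ 2 := by
  have h1 : 0 < 1 - r ^ 2 := by nlinarith
  have hl0 : 0 < l := by rw [hl]; positivity
  have hnn : 0 ≤ P * M * l ^ 2 * ((d ^ 2 * D / (M * l ^ 2) - ((2 - α) * d * v - a ^ 2 * u)) ^ 2 +
      d ^ 2 * (2 - α) * h * ((ν - 1) * v ^ 2 + (ν - 3) * T) +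
      (a ^ 2 - κ) * (d * v + a * u) ^ 2 + d ^ 2 * T * (2 * c * a - c ^ 2 - κ) +
      a ^ 3 * (ν - 1) * h * u ^ 2) := by
    have e1 : 0 ≤ a ^ 2 - κ := by linarith
    have e2 : 0 ≤ 2 * c * a - c ^ 2 - κ := by linarith
    have e3 : 0 ≤ 2 - α := by linarith
    have e4 : 0 ≤ ν - 1 := by linarith
    have e5 : 0 ≤ ν - 3 := by linarith
    positivity
  rw [← sub_nonneg]
  refine hnn.trans_eq ?_
  rw [hh, hl, ha, hc]
  field_simp
  ring

end PointwiseIdentity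

section Profiles

/-- Hyperbolic distance to the origin as a function of the Euclidean radius. -/
noncomputable def distProfile (r : ℝ) : ℝ := Real.log ((1 + r) / (1 - r))

/-- Conformal factor as a function of the Euclidean radius. -/
noncomputable def confProfile (r : ℝ) : ℝ := 2 / (1 - r ^ 2)

variable {r : ℝ}

lemma confProfile_pos (hr : 0 < r) (hr1 : r < 1) : 0 < confProfile r :=
  div_pos two_pos (by nlinarith)

lemma two_mul_le_distProfile (hr : 0 < r) (hr1 : r < 1) : 2 * r ≤ distProfile r := by
  have h := Real.hasSum_log_sub_log_of_abs_lt_one (x := r) (by rwa [abs_of_pos hr])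
  rw [distProfile, Real.log_div (by linarith) (by linarith)]
  simpa using sum_le_hasSum {0} (fun k _ => by positivity) h

lemma distProfile_pos (hr : 0 < r) (hr1 : r < 1) : 0 < distProfile r :=
  (by linarith : 0 < 2 * r).trans_le (two_mul_le_distProfile hr hr1)

lemma distProfile_le (hr : 0 < r) (hr1 : r < 1) : distProfile r ≤ r * confProfile r := by
  have h1 : 0 < 1 - r := by linarith
  have h2 : 0 < 1 - r ^ 2 := by nlinarith
  have h0 : 0 < (1 + r) / (1 - r) := by positivity
  have := Real.self_le_sinh_iff.2 (distProfile_pos hr hr1).le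
  unfold distProfile at this ⊢
  rw [Real.sinh_log h0] at this
  refine this.trans_eq ?_
  rw [confProfile, show 1 - r ^ 2 = (1 - r) * (1 + r) by ring]
  field_simp
  ring

lemma hasDerivAt_distProfile (hr : 0 < r) (hr1 : r < 1) :
    HasDerivAt distProfile (confProfile r) r := by
  have h1 : 1 - r ≠ 0 := by linarith
  have h2 : 1 + r ≠ 0 := by linarith
  have h3 : 1 - r ^ 2 ≠ 0 := by nlinarith
  have := (((hasDerivAt_id r).const_add 1).div ((hasDerivAt_id r).const_sub 1) h1).log
    (div_ne_zero h2 h1)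
  refine this.congr_deriv ?_
  simp only [confProfile, id, Pi.div_apply]
  rw [show 1 - r ^ 2 = (1 - r) * (1 + r) by ring]
  field_simp
  ring

lemma hasDerivAt_confProfile (hr : 0 < r) (hr1 : r < 1) :
    HasDerivAt confProfile (r * confProfile r ^ 2) r := by
  have h3 : 1 - r ^ 2 ≠ 0 := by nlinarith
  have := ((hasDerivAt_const r (2 : ℝ)).div ((hasDerivAt_pow 2 r).const_sub 1) h3)
  refine this.congr_deriv ?_
  simp only [confProfile]
  field_simp
  ring

lemma contDiffAt_distProfile (hr : 0 < r) (hr1 : r < 1) : ContDiffAt ℝ 1 distProfile r := by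
  have h1 : 1 - r ≠ 0 := by linarith
  have h2 : 1 + r ≠ 0 := by linarith
  exact ((contDiffAt_const.add contDiffAt_id).div (contDiffAt_const.sub contDiffAt_id) h1).log
    (div_ne_zero h2 h1)

lemma contDiffAt_confProfile (hr : 0 < r) (hr1 : r < 1) : ContDiffAt ℝ 1 confProfile r := by
  have h3 : 1 - r ^ 2 ≠ 0 := by nlinarith
  exact contDiffAt_const.div (contDiffAt_const.sub (contDiffAt_id.pow 2)) h3

lemma hasDerivAt_distProfile_rpow (s : ℝ) (hr : 0 < r) (hr1 : r < 1) :
    HasDerivAt (fun t => distProfile t ^ s)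
      (s * distProfile r ^ s / distProfile r * confProfile r) r := by
  have hd := distProfile_pos hr hr1
  refine ((hasDerivAt_distProfile hr hr1).rpow_const (p := s) (Or.inl hd.ne')).congr_deriv ?_
  rw [Real.rpow_sub_one hd.ne']
  ring

lemma hasDerivAt_confProfile_rpow (s : ℝ) (hr : 0 < r) (hr1 : r < 1) :
    HasDerivAt (fun t => confProfile t ^ s) (s * confProfile r ^ s * r * confProfile r) r := by
  have hl := confProfile_pos hr hr1
  refine ((hasDerivAt_confProfile hr hr1).rpow_const (p := s) (Or.inl hl.ne')).congr_deriv ?_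
  rw [Real.rpow_sub_one hl.ne']
  field_simp

lemma hasDerivAt_rellichRadial (α : ℝ) (hr : 0 < r) (hr1 : r < 1) :
    HasDerivAt
      (fun t => 2 * (2 - α) * (distProfile t ^ (α - 4) * distProfile t ^ 3 / (t * confProfile t)))
      (2 * (2 - α) * (distProfile r ^ (α - 4) * ((α - 1) * distProfile r ^ 2 / r -
        distProfile r ^ 3 - distProfile r ^ 3 / (confProfile r * r ^ 2)))) r := by
  have hd := distProfile_pos hr hr1
  have hl := confProfile_pos hr hr1
  refine ((((hasDerivAt_distProfile_rpow (α - 4) hr hr1).mul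
    ((hasDerivAt_distProfile hr hr1).pow 3)).div ((hasDerivAt_id r).mul
    (hasDerivAt_confProfile hr hr1)) (mul_pos hr hl).ne').const_mul (2 * (2 - α))).congr_deriv ?_
  simp only [Pi.mul_apply, Pi.pow_apply, id]
  field_simp
  push_cast
  ring

lemma hasDerivAt_rellichFunction (α a : ℝ) (hr : 0 < r) (hr1 : r < 1) :
    HasDerivAt (fun t => -2 * a ^ 2 * (distProfile t ^ (α - 4) * distProfile t ^ 2))
      (-2 * a ^ 2 * ((α - 2) * (distProfile r ^ (α - 4) * distProfile r) * confProfile r)) r := by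
  have hd := distProfile_pos hr hr1
  refine (((hasDerivAt_distProfile_rpow (α - 4) hr hr1).mul
    ((hasDerivAt_distProfile hr hr1).pow 2)).const_mul (-2 * a ^ 2)).congr_deriv ?_
  simp only [Pi.pow_apply]
  field_simp
  push_cast
  ring

lemma hasDerivAt_rellichPotential (ν α a : ℝ) (hr : 0 < r) (hr1 : r < 1) :
    HasDerivAt
      (fun t => -a ^ 3 * (distProfile t ^ (α - 4) * distProfile t * confProfile t ^ (ν - 2) *
        confProfile t / t))
      (-a ^ 3 * (confProfile r ^ (ν - 2) * distProfile r ^ (α - 4) *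
        ((α - 3) * confProfile r ^ 2 / r + (ν - 1) * distProfile r * confProfile r ^ 2 -
          distProfile r * confProfile r / r ^ 2))) r := by
  have hd := distProfile_pos hr hr1
  have hl := confProfile_pos hr hr1
  refine ((((((hasDerivAt_distProfile_rpow (α - 4) hr hr1).mul
    (hasDerivAt_distProfile hr hr1)).mul (hasDerivAt_confProfile_rpow (ν - 2) hr hr1)).mul
    (hasDerivAt_confProfile hr hr1)).div (hasDerivAt_id r) hr.ne').const_mul
    (-a ^ 3)).congr_deriv ?_
  simp only [Pi.mul_apply, id]
  field_simp
  ring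

end Profiles

section Remainder

variable {n : ℕ}

local notation "𝔼" => EuclideanSpace ℝ (Fin n)

local notation "𝔹₀" => Metric.ball (0 : EuclideanSpace ℝ (Fin n)) 1 \ {0}

lemma norm_pos_and_lt_one {x : 𝔼} (hx : x ∈ 𝔹₀) : 0 < ‖x‖ ∧ ‖x‖ < 1 :=
  ⟨norm_pos_iff.2 hx.2, by simpa using hx.1⟩

lemma ne_zero_of_mem {x : 𝔼} (hx : x ∈ 𝔹₀) : x ≠ 0 := hx.2

lemma contDiffAt_comp_norm {F : ℝ → ℝ} {x : 𝔼} (hx : x ≠ 0) (hF : ContDiffAt ℝ 1 F ‖x‖) :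
    ContDiffAt ℝ 1 (fun y : 𝔼 => F ‖y‖) x :=
  hF.comp x (contDiffAt_norm ℝ hx)

lemma contDiffAt_dH {x : 𝔼} (hx : x ∈ 𝔹₀) : ContDiffAt ℝ 1 (dH (n := n)) x := by
  obtain ⟨h0, h1⟩ := norm_pos_and_lt_one hx
  exact contDiffAt_comp_norm (ne_zero_of_mem hx) (contDiffAt_distProfile h0 h1)

lemma contDiffAt_lam {x : 𝔼} (hx : x ∈ 𝔹₀) : ContDiffAt ℝ 1 (lam (n := n)) x := by
  obtain ⟨h0, h1⟩ := norm_pos_and_lt_one hx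
  exact contDiffAt_comp_norm (ne_zero_of_mem hx) (contDiffAt_confProfile h0 h1)

lemma dH_pos {x : 𝔼} (hx : x ∈ 𝔹₀) : 0 < dH x :=
  distProfile_pos (norm_pos_and_lt_one hx).1 (norm_pos_and_lt_one hx).2

lemma lam_pos {x : 𝔼} (hx : x ∈ 𝔹₀) : 0 < lam x :=
  confProfile_pos (norm_pos_and_lt_one hx).1 (norm_pos_and_lt_one hx).2

/-- The vector field whose divergence relates the Rellich quotient to its remainder. -/
noncomputable def rellichField (α a : ℝ) (φ : 𝔼 → ℝ) (y : 𝔼) : 𝔼 :=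
  (2 * (2 - α) * (distProfile ‖y‖ ^ (α - 4) * distProfile ‖y‖ ^ 3 / (‖y‖ * confProfile ‖y‖)) *
      inner ℝ y (gradient φ y) +
    -2 * a ^ 2 * (distProfile ‖y‖ ^ (α - 4) * distProfile ‖y‖ ^ 2) * φ y) •
      (confProfile ‖y‖ ^ ((n : ℝ) - 2) • gradient φ y) +
  (-a ^ 3 * (distProfile ‖y‖ ^ (α - 4) * distProfile ‖y‖ * confProfile ‖y‖ ^ ((n : ℝ) - 2) *
        confProfile ‖y‖ / ‖y‖) * φ y ^ 2 -
    2 * (2 - α) * (distProfile ‖y‖ ^ (α - 4) * distProfile ‖y‖ ^ 3 / (‖y‖ * confProfile ‖y‖)) *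
      confProfile ‖y‖ ^ ((n : ℝ) - 2) * (1 / 2) * ‖gradient φ y‖ ^ 2) • y

lemma tsupport_rellichField_subset (α a : ℝ) (φ : 𝔼 → ℝ) :
    tsupport (rellichField α a φ) ⊆ tsupport φ := by
  refine closure_minimal (fun x hx => by_contra fun h => hx ?_) (isClosed_tsupport φ)
  simp [rellichField, image_eq_zero_of_notMem_tsupport h, gradient_eq_zero_of_notMem_tsupport h]

lemma contDiff_rellichField (α a : ℝ) {φ : 𝔼 → ℝ} (hφ : ContDiff ℝ (⊤ : ℕ∞) φ)
    (hs : tsupport φ ⊆ 𝔹₀) : ContDiff ℝ 1 (rellichField α a φ) := by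
  refine contDiff_of_contDiffAt_tsupport fun x hx => ?_
  have hx' := hs (tsupport_rellichField_subset α a φ hx)
  have hd := contDiffAt_dH hx'
  have hl := contDiffAt_lam hx'
  have hd0 := (dH_pos hx').ne'
  have hl0 := (lam_pos hx').ne'
  have hG : ContDiffAt ℝ 1 (gradient φ) x :=
    ((contDiff_gradient hφ).of_le (by exact_mod_cast le_top)).contDiffAt
  have hf : ContDiffAt ℝ 1 φ x := (hφ.of_le (by exact_mod_cast le_top)).contDiffAt
  have hN : ContDiffAt ℝ 1 (fun y : 𝔼 => ‖y‖) x := contDiffAt_norm ℝ (ne_zero_of_mem hx')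
  have hN0 : ‖x‖ ≠ 0 := norm_ne_zero_iff.2 (ne_zero_of_mem hx')
  have hi : ContDiffAt ℝ 1 (fun y : 𝔼 => y) x := contDiffAt_id
  have hP := hd.rpow_const_of_ne (p := α - 4) hd0
  have hM := hl.rpow_const_of_ne (p := (n : ℝ) - 2) hl0
  have hg := contDiffAt_const (c := 2 * (2 - α)) |>.mul
    ((hP.mul (hd.pow 3)).div (hN.mul hl) (mul_ne_zero hN0 hl0))
  have hp := contDiffAt_const (c := -2 * a ^ 2) |>.mul (hP.mul (hd.pow 2))
  have hk := contDiffAt_const (c := -a ^ 3) |>.mul ((((hP.mul hd).mul hM).mul hl).div hN hN0)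
  exact (((hg.mul (hi.inner ℝ hG)).add (hp.mul hf)).smul (hM.smul hG)).add
    (((hk.mul (hf.pow 2)).sub (((hg.mul hM).mul contDiffAt_const).mul (hG.norm_sq ℝ))).smul hi)

lemma norm_sq_gradient_dH_rpow_mul (a : ℝ) {φ : 𝔼 → ℝ} (hφ : ContDiff ℝ (⊤ : ℕ∞) φ) {x : 𝔼}
    (hx : x ∈ 𝔹₀) :
    ‖gradient (fun y => dH y ^ a * φ y) x‖ ^ 2 = dH x ^ (2 * a) * (‖gradient φ x‖ ^ 2 +
      2 * (a * φ x * lam x / (dH x * ‖x‖)) * inner ℝ x (gradient φ x) +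
      (a * φ x * lam x / dH x) ^ 2) := by
  obtain ⟨h0, h1⟩ := norm_pos_and_lt_one hx
  have hd := dH_pos hx
  have hfd := (hasFDerivAt_comp_norm (ne_zero_of_mem hx) (hasDerivAt_distProfile_rpow a h0 h1)).mul
    (hφ.differentiable (by simp) x).hasFDerivAt
  have hgr : gradient (fun y => dH y ^ a * φ y) x =
      dH x ^ a • (gradient φ x + (a * φ x * lam x / (dH x * ‖x‖)) • x) := by
    refine HasGradientAt.gradient ?_
    rw [hasGradientAt_iff_hasFDerivAt]
    refine hfd.congr_fderiv ?_
    ext v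
    have : fderiv ℝ φ x v = inner ℝ (gradient φ x) v := (inner_gradient x v).symm
    simp only [add_apply, smul_apply, innerSL_apply_apply, smul_eq_mul, this,
      InnerProductSpace.toDual_apply_apply, inner_smul_left, inner_add_left, conj_trivial]
    change dH x ^ a * _ + φ x * (a * dH x ^ a / dH x * lam x / ‖x‖ * _) = _
    field_simp
  rw [hgr, norm_smul, mul_pow, norm_add_sq_real, norm_smul, inner_smul_right, real_inner_comm,
    Real.norm_of_nonneg (by positivity), mul_pow, Real.norm_eq_abs, sq_abs, mul_comm 2 a,
    Real.rpow_mul hd.le, ← Real.rpow_natCast (dH x ^ a) 2, Nat.cast_ofNat]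
  field_simp

/-- Pointwise weighted Rellich inequality with gradient remainder, up to a divergence. -/
lemma rellich_pointwise (hn : 3 ≤ n) {α a c κ : ℝ} (hα : α < 2) (ha : a = ((n : ℝ) + α - 4) / 2)
    (hc : c = ((n : ℝ) - α) / 2) (ha0 : 0 < a) (hκ₀ : 0 ≤ κ) (hκ₁ : κ ≤ a ^ 2)
    (hκ₂ : κ ≤ 2 * c * a - c ^ 2) {φ : 𝔼 → ℝ} (hφ : ContDiff ℝ (⊤ : ℕ∞) φ) {x : 𝔼}
    (hx : x ∈ 𝔹₀) :
    c ^ 2 * (dH x ^ (α - 2) * ‖gradient φ x‖ ^ 2 * lam x ^ ((n : ℝ) - 2)) +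
      κ * (‖x‖ ^ (2 - (n : ℝ)) * ‖gradient (fun y => dH y ^ a * φ y) x‖ ^ 2) +
      dvg (rellichField α a φ) x ≤
    dH x ^ α * lam x ^ (-(n : ℝ)) *
      (dvg (fun y => lam y ^ ((n : ℝ) - 2) • gradient φ y) x) ^ 2 := by
  obtain ⟨h0, h1⟩ := norm_pos_and_lt_one hx
  have hd := dH_pos hx
  have hl := lam_pos hx
  have hn' : (3 : ℝ) ≤ n := by exact_mod_cast hn
  set e := inner ℝ x (gradient φ x) with he
  set v := e / (‖x‖ * lam x) with hv
  set T := ‖gradient φ x‖ ^ 2 / lam x ^ 2 - v ^ 2 with hT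
  have hev : e = ‖x‖ * lam x * v := by rw [hv]; field_simp
  have hGT : ‖gradient φ x‖ ^ 2 = lam x ^ 2 * (v ^ 2 + T) := by rw [hT]; field_simp; ring
  have hT0 : 0 ≤ T := by
    have h2 : e ^ 2 ≤ ‖x‖ ^ 2 * ‖gradient φ x‖ ^ 2 := by
      rw [← mul_pow, ← sq_abs e]
      exact pow_le_pow_left₀ (abs_nonneg _) (abs_real_inner_le_norm _ _) 2
    have h3 : 0 ≤ ‖x‖ ^ 2 * lam x ^ 2 * T := by rw [hev, hGT] at h2; nlinarith
    exact nonneg_of_mul_nonneg_right h3 (by positivity)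
  have hh0 : 0 ≤ dH x * ((1 + ‖x‖ ^ 2) / (2 * ‖x‖)) - 1 := by
    have h2 : 2 * ‖x‖ ≤ dH x := two_mul_le_distProfile h0 h1
    rw [sub_nonneg, mul_div_assoc', le_div_iff₀ (by positivity)]
    nlinarith [mul_pos hd (pow_pos h0 2)]
  have key := rellich_algebra (D := dvg (fun y => lam y ^ ((n : ℝ) - 2) • gradient φ y) x)
    (u := φ x) (v := v) hn' hα ha hc ha0 hκ₁ hκ₂ hd h0 h1 (rfl : lam x = _)
    (Real.rpow_pos_of_pos hl ((n : ℝ) - 2)) (Real.rpow_pos_of_pos hd (α - 4)) hT0 rfl hh0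
  rw [← hev, ← hGT] at key
  have hW := dvg_radial_field hφ (ne_zero_of_mem hx) (hasDerivAt_rellichRadial α h0 h1)
    (hasDerivAt_rellichFunction α a h0 h1) (hasDerivAt_confProfile_rpow ((n : ℝ) - 2) h0 h1)
    (hasDerivAt_rellichPotential (n : ℝ) α a h0 h1)
  change dvg (rellichField α a φ) x = _ at hW
  have e1 : dH x ^ (α - 2) = dH x ^ (α - 4) * dH x ^ 2 := by
    rw [← Real.rpow_add_natCast hd.ne']; congr 1; push_cast; ring
  have e2 : dH x ^ α = dH x ^ (α - 4) * dH x ^ 4 := by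
    rw [← Real.rpow_add_natCast hd.ne']; congr 1; push_cast; ring
  have e3 : lam x ^ (-(n : ℝ)) = (lam x ^ ((n : ℝ) - 2) * lam x ^ 2)⁻¹ := by
    rw [← Real.rpow_add_natCast hl.ne', Real.rpow_neg hl.le]; congr 2; push_cast; ring
  have hr : ‖x‖ ^ (2 - (n : ℝ)) ≤ dH x ^ (2 - (n : ℝ)) * lam x ^ ((n : ℝ) - 2) := by
    have h2 : (‖x‖ * lam x) ^ (2 - (n : ℝ)) ≤ dH x ^ (2 - (n : ℝ)) :=
      Real.rpow_le_rpow_of_nonpos hd (distProfile_le h0 h1) (by linarith)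
    rw [Real.mul_rpow h0.le hl.le] at h2
    refine le_trans (le_of_eq ?_)
      (mul_le_mul_of_nonneg_right h2 (Real.rpow_pos_of_pos hl ((n : ℝ) - 2)).le)
    rw [mul_assoc, ← Real.rpow_add hl, sub_add_sub_cancel, sub_self, Real.rpow_zero, mul_one]
  have hB : ‖x‖ ^ (2 - (n : ℝ)) * ‖gradient (fun y => dH y ^ a * φ y) x‖ ^ 2 ≤
      dH x ^ (α - 4) * dH x ^ 2 * lam x ^ ((n : ℝ) - 2) *
        (lam x ^ 2 * (T + (v + a * φ x / dH x) ^ 2)) := by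
    refine (mul_le_mul_of_nonneg_right hr (sq_nonneg _)).trans_eq ?_
    rw [norm_sq_gradient_dH_rpow_mul a hφ hx, ← he, hGT, hev, ← e1,
      show α - 2 = (2 - (n : ℝ)) + 2 * a by rw [ha]; ring, Real.rpow_add hd]
    field_simp
    ring
  have key' := le_of_eq_of_le (congrArg (_ + ·) hW) key
  have hB' := mul_le_mul_of_nonneg_left hB hκ₀
  rw [e1, e2, e3]
  linarith

lemma tsupport_smul_gradient_subset (s φ : 𝔼 → ℝ) :
    tsupport (fun y => s y • gradient φ y) ⊆ tsupport φ :=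
  closure_minimal (fun y hy => by_contra fun h => hy <| by
    simp [gradient_eq_zero_of_notMem_tsupport h]) (isClosed_tsupport φ)

lemma continuous_gradient {ψ : 𝔼 → ℝ} (hψ : ContDiff ℝ 1 ψ) : Continuous (gradient ψ) :=
  (InnerProductSpace.toDual ℝ 𝔼).symm.continuous.comp (hψ.continuous_fderiv one_ne_zero)

lemma contDiff_dH_rpow_mul (a : ℝ) {φ : 𝔼 → ℝ} (hφ : ContDiff ℝ (⊤ : ℕ∞) φ)
    (hs : tsupport φ ⊆ 𝔹₀) : ContDiff ℝ 1 (fun y => dH y ^ a * φ y) :=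
  contDiff_of_contDiffAt_tsupport fun x hx => by
    have hx' := hs (tsupport_mul_subset_right hx)
    exact ((contDiffAt_dH hx').rpow_const_of_ne (dH_pos hx').ne').mul
      (hφ.of_le (by exact_mod_cast le_top)).contDiffAt

lemma contDiff_lam_rpow_smul_gradient (s : ℝ) {φ : 𝔼 → ℝ} (hφ : ContDiff ℝ (⊤ : ℕ∞) φ)
    (hs : tsupport φ ⊆ 𝔹₀) : ContDiff ℝ 1 (fun y => lam y ^ s • gradient φ y) :=
  contDiff_of_contDiffAt_tsupport fun x hx => by
    have hx' := hs (tsupport_smul_gradient_subset _ φ hx)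
    exact ((contDiffAt_lam hx').rpow_const_of_ne (lam_pos hx').ne').smul
      ((contDiff_gradient hφ).of_le (by exact_mod_cast le_top)).contDiffAt

/-- Weighted Rellich inequality on the Poincaré ball with a gradient remainder. -/
lemma rellich_remainder (hn : 3 ≤ n) {α a c κ : ℝ} (hα : α < 2) (ha : a = ((n : ℝ) + α - 4) / 2)
    (hc : c = ((n : ℝ) - α) / 2) (ha0 : 0 < a) (hκ₀ : 0 ≤ κ) (hκ₁ : κ ≤ a ^ 2)
    (hκ₂ : κ ≤ 2 * c * a - c ^ 2) {φ : 𝔼 → ℝ} (hφ : ContDiff ℝ (⊤ : ℕ∞) φ)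
    (hK : HasCompactSupport φ) (hs : tsupport φ ⊆ 𝔹₀) :
    c ^ 2 * (∫ x in Metric.ball (0 : 𝔼) 1,
        dH x ^ (α - 2) * ‖gradient φ x‖ ^ 2 * lam x ^ ((n : ℝ) - 2)) +
      κ * (∫ x in Metric.ball (0 : 𝔼) 1,
        ‖x‖ ^ (2 - (n : ℝ)) * ‖gradient (fun y => dH y ^ a * φ y) x‖ ^ 2) ≤
    ∫ x in Metric.ball (0 : 𝔼) 1, dH x ^ α * lam x ^ (-(n : ℝ)) *
      (dvg (fun y => lam y ^ ((n : ℝ) - 2) • gradient φ y) x) ^ 2 := by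
  have hdH : ContinuousOn (dH (n := n)) (tsupport φ) := fun x hx =>
    (contDiffAt_dH (hs hx)).continuousAt.continuousWithinAt
  have hlam : ContinuousOn (lam (n := n)) (tsupport φ) := fun x hx =>
    (contDiffAt_lam (hs hx)).continuousAt.continuousWithinAt
  have hdHp (s : ℝ) : ContinuousOn (fun x => dH (n := n) x ^ s) (tsupport φ) :=
    hdH.rpow_const fun x hx => Or.inl (dH_pos (hs hx)).ne'
  have hlamp (s : ℝ) : ContinuousOn (fun x => lam (n := n) x ^ s) (tsupport φ) :=
    hlam.rpow_const fun x hx => Or.inl (lam_pos (hs hx)).ne'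
  have hgrad : ContinuousOn (gradient φ) (tsupport φ) :=
    (contDiff_gradient hφ).continuous.continuousOn
  have hψ := continuous_gradient (contDiff_dH_rpow_mul a hφ hs)
  have hV := continuous_dvg (contDiff_lam_rpow_smul_gradient ((n : ℝ) - 2) hφ hs)
  have hg0 {x : 𝔼} (hx : x ∉ tsupport φ) : gradient φ x = 0 :=
    gradient_eq_zero_of_notMem_tsupport hx
  have hψ0 {x : 𝔼} (hx : x ∉ tsupport φ) : gradient (fun y => dH y ^ a * φ y) x = 0 :=
    gradient_eq_zero_of_notMem_tsupport fun h => hx (tsupport_mul_subset_right h)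
  have hV0 {x : 𝔼} (hx : x ∉ tsupport φ) :
      dvg (fun y => lam y ^ ((n : ℝ) - 2) • gradient φ y) x = 0 :=
    dvg_eq_zero_of_notMem_tsupport fun h => hx (tsupport_smul_gradient_subset _ φ h)
  have i1 : Integrable fun x : 𝔼 =>
      dH x ^ (α - 2) * ‖gradient φ x‖ ^ 2 * lam x ^ ((n : ℝ) - 2) :=
    integrable_of_continuousOn_of_eq_zero hK (((hdHp _).mul (hgrad.norm.pow 2)).mul (hlamp _))
      fun x hx => by simp [hg0 hx]
  have i2 : Integrable fun x : 𝔼 =>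
      ‖x‖ ^ (2 - (n : ℝ)) * ‖gradient (fun y => dH y ^ a * φ y) x‖ ^ 2 :=
    integrable_of_continuousOn_of_eq_zero hK ((continuous_norm.continuousOn.rpow_const
      fun x hx => Or.inl (norm_pos_and_lt_one (hs hx)).1.ne').mul (hψ.norm.pow 2).continuousOn)
      fun x hx => by simp [hψ0 hx]
  have i3 : Integrable fun x : 𝔼 => dH x ^ α * lam x ^ (-(n : ℝ)) *
      (dvg (fun y => lam y ^ ((n : ℝ) - 2) • gradient φ y) x) ^ 2 :=
    integrable_of_continuousOn_of_eq_zero hK (((hdHp _).mul (hlamp _)).mul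
      (hV.pow 2).continuousOn) fun x hx => by simp [hV0 hx]
  have i12 : Integrable fun x : 𝔼 =>
      c ^ 2 * (dH x ^ (α - 2) * ‖gradient φ x‖ ^ 2 * lam x ^ ((n : ℝ) - 2)) +
        κ * (‖x‖ ^ (2 - (n : ℝ)) * ‖gradient (fun y => dH y ^ a * φ y) x‖ ^ 2) :=
    (i1.const_mul _).add (i2.const_mul _)
  have hWs := tsupport_rellichField_subset α a φ
  have hW := contDiff_rellichField α a hφ hs
  have i4 : Integrable (dvg (rellichField α a φ)) :=
    integrable_of_continuousOn_of_eq_zero hK (continuous_dvg hW).continuousOn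
      fun x hx => dvg_eq_zero_of_notMem_tsupport fun h => hx (hWs h)
  have hWi := setIntegral_dvg_eq_zero (s := Metric.ball (0 : 𝔼) 1) hW
    (hK.of_isClosed_subset (isClosed_tsupport _) hWs) (fun x hx => (hs (hWs hx)).1)
  rw [← add_zero (_ + _), ← hWi, ← integral_const_mul, ← integral_const_mul,
    ← integral_add (i1.const_mul _).integrableOn (i2.const_mul _).integrableOn,
    ← integral_add i12.integrableOn i4.integrableOn]
  refine setIntegral_mono (i12.add i4).integrableOn
    i3.integrableOn fun x => ?_
  by_cases hx : x ∈ tsupport φ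
  · exact rellich_pointwise hn hα ha hc ha0 hκ₀ hκ₁ hκ₂ hφ (hs hx)
  · simp [hg0 hx, hψ0 hx, hV0 hx,
      dvg_eq_zero_of_notMem_tsupport fun h => hx (hWs h)]

end Remainder

section WeightedSobolev

variable {n : ℕ}

local notation "𝔼" => EuclideanSpace ℝ (Fin n)

lemma integrable_norm_rpow_mul {K : Set 𝔼} (hK : IsCompact K) (h0 : (0 : 𝔼) ∉ K) (s : ℝ)
    {g : 𝔼 → ℝ} (hg : Continuous g) (hg0 : ∀ x ∉ K, g x = 0) :
    Integrable fun x : 𝔼 => ‖x‖ ^ s * g x :=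
  integrable_of_continuousOn_of_eq_zero hK
    ((continuous_norm.continuousOn.rpow_const fun x hx =>
      Or.inl (norm_ne_zero_iff.2 (ne_of_mem_of_not_mem hx h0))).mul hg.continuousOn)
    fun x hx => by simp [hg0 x hx]

lemma contDiff_norm_rpow_mul (s : ℝ) {g : 𝔼 → ℝ} (hg : ContDiff ℝ 1 g)
    (h0 : (0 : 𝔼) ∉ tsupport g) : ContDiff ℝ 1 (fun x => ‖x‖ ^ s * g x) :=
  contDiff_of_contDiffAt_tsupport fun x hx => by
    have hx0 : x ≠ 0 := ne_of_mem_of_not_mem (tsupport_mul_subset_right hx) h0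
    exact ((contDiffAt_norm ℝ hx0).rpow_const_of_ne (norm_ne_zero_iff.2 hx0)).mul hg.contDiffAt

lemma hasFDerivAt_norm_rpow_of_ne (s : ℝ) {x : 𝔼} (hx : x ≠ 0) :
    HasFDerivAt (fun y : 𝔼 => ‖y‖ ^ s) ((s * ‖x‖ ^ s / ‖x‖ ^ 2) • innerSL ℝ x) x := by
  have h := norm_pos_iff.2 hx
  refine (hasFDerivAt_comp_norm hx
    (Real.hasDerivAt_rpow_const (p := s) (Or.inl h.ne'))).congr_fderiv ?_
  rw [Real.rpow_sub_one h.ne']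
  congr 1
  field_simp

lemma hardy_pointwise {σ : ℝ} (hσ : σ < n) {ψ : 𝔼 → ℝ} (hψ : ContDiff ℝ 1 ψ) {x : 𝔼}
    (hx : x ≠ 0) :
    ‖x‖ ^ (-σ) * ψ x ^ 2 ≤ 4 / ((n : ℝ) - σ) ^ 2 * (‖x‖ ^ (2 - σ) * ‖gradient ψ x‖ ^ 2) +
      2 / ((n : ℝ) - σ) * dvg (fun y => (‖y‖ ^ (-σ) * ψ y ^ 2) • y) x := by
  have h := norm_pos_iff.2 hx
  have hm : 0 < (n : ℝ) - σ := sub_pos.2 hσ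
  have hF : HasFDerivAt (fun y : 𝔼 => ‖y‖ ^ (-σ) * ψ y ^ 2) _ x :=
    (hasFDerivAt_norm_rpow_of_ne (-σ) hx).mul
    ((hψ.differentiable one_ne_zero x).hasFDerivAt.pow 2)
  have hD : dvg (fun y => (‖y‖ ^ (-σ) * ψ y ^ 2) • y) x =
      ‖x‖ ^ (-σ) * (((n : ℝ) - σ) * ψ x ^ 2 + 2 * ψ x * inner ℝ (gradient ψ x) x) := by
    rw [dvg_smul_id hF.differentiableAt, hF.fderiv, inner_gradient]
    simp
    field_simp
    ring
  have he : inner ℝ (gradient ψ x) x ^ 2 ≤ ‖x‖ ^ 2 * ‖gradient ψ x‖ ^ 2 := by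
    rw [← mul_pow, ← sq_abs, mul_comm]
    exact pow_le_pow_left₀ (abs_nonneg _) (abs_real_inner_le_norm _ _) 2
  have hs : ‖x‖ ^ (2 - σ) = ‖x‖ ^ (-σ) * ‖x‖ ^ 2 := by
    rw [← Real.rpow_add_natCast h.ne']; congr 1; push_cast; ring
  rw [hD, hs]
  generalize inner ℝ (gradient ψ x) x = e at *
  generalize (n : ℝ) - σ = m at *
  have key : ψ x ^ 2 ≤ 4 / m ^ 2 * (‖x‖ ^ 2 * ‖gradient ψ x‖ ^ 2) +
      2 / m * (m * ψ x ^ 2 + 2 * ψ x * e) := by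
    have h1 : 4 / m ^ 2 * e ^ 2 ≤ 4 / m ^ 2 * (‖x‖ ^ 2 * ‖gradient ψ x‖ ^ 2) := by gcongr
    have h2 : 4 / m ^ 2 * e ^ 2 + 2 / m * (m * ψ x ^ 2 + 2 * ψ x * e) - ψ x ^ 2 =
      (2 / m * e + ψ x) ^ 2 := by field_simp; ring
    nlinarith [sq_nonneg (2 / m * e + ψ x)]
  calc _ ≤ _ := mul_le_mul_of_nonneg_left key (Real.rpow_pos_of_pos h (-σ)).le
    _ = _ := by ring

/-- Weighted Hardy inequality. -/
lemma hardy {σ : ℝ} (hσ : σ < n) {ψ : 𝔼 → ℝ} (hψ : ContDiff ℝ 1 ψ) (hK : HasCompactSupport ψ)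
    (h0 : (0 : 𝔼) ∉ tsupport ψ) :
    ∫ x, ‖x‖ ^ (-σ) * ψ x ^ 2 ≤
      4 / ((n : ℝ) - σ) ^ 2 * ∫ x, ‖x‖ ^ (2 - σ) * ‖gradient ψ x‖ ^ 2 := by
  have hψ2 : ∀ x ∉ tsupport ψ, ψ x ^ 2 = 0 := fun x hx => by
    simp [image_eq_zero_of_notMem_tsupport hx]
  have hg2 : ∀ x ∉ tsupport ψ, ‖gradient ψ x‖ ^ 2 = 0 := fun x hx => by
    simp [gradient_eq_zero_of_notMem_tsupport hx]
  have hsub : tsupport (fun y => ψ y ^ 2) ⊆ tsupport ψ :=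
    closure_mono fun y hy h => hy (by simp [h])
  have hVs : tsupport (fun y : 𝔼 => (‖y‖ ^ (-σ) * ψ y ^ 2) • y) ⊆ tsupport ψ :=
    closure_mono fun y hy h => hy (by simp [h])
  have hV : ContDiff ℝ 1 (fun y : 𝔼 => (‖y‖ ^ (-σ) * ψ y ^ 2) • y) :=
    (contDiff_norm_rpow_mul (-σ) (hψ.pow 2) fun h => h0 (hsub h)).smul contDiff_id
  have hVd : ∀ x ∉ tsupport ψ, dvg (fun y : 𝔼 => (‖y‖ ^ (-σ) * ψ y ^ 2) • y) x = 0 :=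
    fun x hx => dvg_eq_zero_of_notMem_tsupport fun h => hx (hVs h)
  have i1 : Integrable fun x => ‖x‖ ^ (-σ) * ψ x ^ 2 :=
    integrable_norm_rpow_mul hK h0 (-σ) (hψ.continuous.pow 2) hψ2
  have i2 : Integrable fun x =>
      4 / ((n : ℝ) - σ) ^ 2 * (‖x‖ ^ (2 - σ) * ‖gradient ψ x‖ ^ 2) :=
    (integrable_norm_rpow_mul hK h0 (2 - σ) ((continuous_gradient hψ).norm.pow 2) hg2).const_mul _
  have i3 := (integrable_of_continuousOn_of_eq_zero hK (continuous_dvg hV).continuousOn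
    hVd).const_mul (2 / ((n : ℝ) - σ))
  have h3 := integral_dvg_eq_zero hV (hK.of_isClosed_subset (isClosed_tsupport _) hVs)
  rw [← integral_const_mul, ← add_zero (∫ x, _ / _ * _), ← mul_zero (2 / ((n : ℝ) - σ)), ← h3,
    ← integral_const_mul (2 / ((n : ℝ) - σ)), ← integral_add i2 i3]
  refine integral_mono i1 (i2.add i3) fun x => ?_
  by_cases hx : x ∈ tsupport ψ
  · exact hardy_pointwise hσ hψ (ne_of_mem_of_not_mem hx h0)
  · simp [hψ2 x hx, hg2 x hx, hVd x hx]

lemma norm_sq_gradient_norm_rpow_mul_le (β : ℝ) {ψ : 𝔼 → ℝ} (hψ : ContDiff ℝ 1 ψ) {x : 𝔼}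
    (hx : x ≠ 0) :
    ‖gradient (fun y => ‖y‖ ^ (-β) * ψ y) x‖ ^ 2 ≤
      2 * (‖x‖ ^ (-(2 * β)) * ‖gradient ψ x‖ ^ 2) +
        2 * β ^ 2 * (‖x‖ ^ (-(2 * β + 2)) * ψ x ^ 2) := by
  have h := norm_pos_iff.2 hx
  have hgr : gradient (fun y => ‖y‖ ^ (-β) * ψ y) x =
      ‖x‖ ^ (-β) • (gradient ψ x + (-β * ψ x / ‖x‖ ^ 2) • x) := by
    refine HasGradientAt.gradient ?_
    rw [hasGradientAt_iff_hasFDerivAt]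
    refine ((hasFDerivAt_norm_rpow_of_ne (-β) hx).mul
      (hψ.differentiable one_ne_zero x).hasFDerivAt).congr_fderiv ?_
    ext v
    simp only [add_apply, smul_apply, innerSL_apply_apply, smul_eq_mul, ← inner_gradient,
      InnerProductSpace.toDual_apply_apply, inner_smul_left, inner_add_left, conj_trivial]
    field_simp
  have e1 : ‖x‖ ^ (-(2 * β)) = (‖x‖ ^ (-β)) ^ 2 := by
    rw [← Real.rpow_natCast, ← Real.rpow_mul h.le]; congr 1; push_cast; ring
  have e2 : (‖x‖ ^ (-β)) ^ 2 = ‖x‖ ^ (-(2 * β + 2)) * ‖x‖ ^ 2 := by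
    rw [← e1, ← Real.rpow_add_natCast h.ne']; congr 1; push_cast; ring
  have e3 : ‖x‖ ^ (-(2 * β + 2)) = (‖x‖ ^ (-β)) ^ 2 / ‖x‖ ^ 2 := by
    rw [e2]; field_simp
  have hsq : ‖gradient ψ x + (-β * ψ x / ‖x‖ ^ 2) • x‖ ^ 2 ≤
      2 * ‖gradient ψ x‖ ^ 2 + 2 * ‖(-β * ψ x / ‖x‖ ^ 2) • x‖ ^ 2 := by
    nlinarith [norm_add_le (gradient ψ x) ((-β * ψ x / ‖x‖ ^ 2) • x),
      norm_nonneg (gradient ψ x + (-β * ψ x / ‖x‖ ^ 2) • x),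
      sq_nonneg (‖gradient ψ x‖ - ‖(-β * ψ x / ‖x‖ ^ 2) • x‖)]
  rw [hgr, norm_smul, mul_pow, Real.norm_of_nonneg (by positivity), e1, e3]
  refine (mul_le_mul_of_nonneg_left hsq (by positivity)).trans_eq ?_
  rw [norm_smul, mul_pow, Real.norm_eq_abs, sq_abs]
  field_simp

/-- Sobolev inequality on the unit ball in integral form. -/
lemma sobolev_ball (hn : 3 ≤ n) {q : ℝ} (hq : 2 ≤ q) (hq' : 1 / 2 - 1 / (n : ℝ) ≤ 1 / q) :
    ∃ C : ℝ, 0 ≤ C ∧ ∀ f : 𝔼 → ℝ, ContDiff ℝ 1 f → HasCompactSupport f →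
      f.support ⊆ Metric.ball 0 1 →
      (∫ x, |f x| ^ q) ^ (2 / q) ≤ C * ∫ x, ‖gradient f x‖ ^ 2 := by
  set C := eLpNormLESNormFDerivOfLeConst ℝ (volume : Measure 𝔼) (Metric.ball 0 1) 2 q.toNNReal
  have hq0 : 0 < q := by linarith
  refine ⟨C ^ 2, by positivity, fun f hf hK hs => ?_⟩
  have h := eLpNorm_le_eLpNorm_fderiv_of_le (μ := (volume : Measure 𝔼)) hf hs (p := 2)
    (q := q.toNNReal) (by norm_num) (by rw [finrank_euclideanSpace_fin]; exact_mod_cast hn)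
    (by simpa [Real.coe_toNNReal q hq0.le] using hq') Metric.isBounded_ball
  have m1 : MemLp f (q.toNNReal : ENNReal) volume := hf.continuous.memLp_of_hasCompactSupport hK
  have m2 : MemLp (fderiv ℝ f) ((2 : NNReal) : ENNReal) volume :=
    (hf.continuous_fderiv one_ne_zero).memLp_of_hasCompactSupport (hK.fderiv ℝ)
  have hq1 : (q.toNNReal : ENNReal) ≠ 0 := by simpa using hq0
  rw [m1.eLpNorm_eq_integral_rpow_norm hq1 ENNReal.coe_ne_top,
    m2.eLpNorm_eq_integral_rpow_norm (by simp) ENNReal.coe_ne_top,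
    ← ENNReal.ofReal_coe_nnreal (p := C),
    ← ENNReal.ofReal_mul C.coe_nonneg, ENNReal.ofReal_le_ofReal_iff (by positivity)] at h
  simp only [ENNReal.coe_toReal, Real.coe_toNNReal q hq0.le, NNReal.coe_ofNat,
    Real.norm_eq_abs] at h
  have e1 : (∫ x, |f x| ^ q) ^ (2 / q) = ((∫ x, |f x| ^ q) ^ q⁻¹) ^ 2 := by
    rw [← Real.rpow_natCast, ← Real.rpow_mul (by positivity)]; congr 1; push_cast; field_simp
  have e2 : ((∫ x, ‖fderiv ℝ f x‖ ^ (2 : ℝ)) ^ (2 : ℝ)⁻¹) ^ 2 = ∫ x, ‖gradient f x‖ ^ 2 := by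
    rw [← Real.rpow_natCast, ← Real.rpow_mul (by positivity)]
    simp [gradient]
  rw [e1, ← e2, ← mul_pow]
  exact pow_le_pow_left₀ (by positivity) h 2

lemma integral_weighted_gradient_mono {s t : ℝ} (hst : s ≤ t) {ψ : 𝔼 → ℝ} (hψ : ContDiff ℝ 1 ψ)
    (hK : HasCompactSupport ψ) (hs : tsupport ψ ⊆ Metric.ball 0 1 \ {0}) :
    ∫ x, ‖x‖ ^ t * ‖gradient ψ x‖ ^ 2 ≤ ∫ x, ‖x‖ ^ s * ‖gradient ψ x‖ ^ 2 := by
  have h0 : (0 : 𝔼) ∉ tsupport ψ := fun h => (hs h).2 rfl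
  have hg2 : ∀ x ∉ tsupport ψ, ‖gradient ψ x‖ ^ 2 = 0 := fun x hx => by
    simp [gradient_eq_zero_of_notMem_tsupport hx]
  have hc := (continuous_gradient hψ).norm.pow 2
  refine integral_mono (integrable_norm_rpow_mul hK h0 t hc hg2)
    (integrable_norm_rpow_mul hK h0 s hc hg2) fun x => ?_
  by_cases hx : x ∈ tsupport ψ
  · obtain ⟨h1, h2⟩ := norm_pos_and_lt_one (hs hx)
    exact mul_le_mul_of_nonneg_right (Real.rpow_le_rpow_of_exponent_ge h1 h2.le hst) (sq_nonneg _)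
  · simp [hg2 x hx]

/-- Sobolev inequality on the unit ball with weight `‖x‖ ^ (2 - n)`, away from the origin. -/
lemma weighted_sobolev (hn : 3 ≤ n) {q : ℝ} (hq : 2 ≤ q) (hq' : 1 / 2 - 1 / (n : ℝ) ≤ 1 / q) :
    ∃ C : ℝ, 0 < C ∧ ∀ ψ : 𝔼 → ℝ, ContDiff ℝ 1 ψ → HasCompactSupport ψ →
      tsupport ψ ⊆ Metric.ball 0 1 \ {0} →
      (∫ x, ‖x‖ ^ (2 - (n : ℝ)) * |ψ x| ^ q) ^ (2 / q) ≤
        C * ∫ x, ‖x‖ ^ (2 - (n : ℝ)) * ‖gradient ψ x‖ ^ 2 := by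
  have hn' : (3 : ℝ) ≤ n := by exact_mod_cast hn
  rcases hq.eq_or_lt with rfl | hq2
  · refine ⟨1, one_pos, fun ψ hψ hK hs => ?_⟩
    have h := hardy (σ := (n : ℝ) - 2) (by linarith) hψ hK fun h => (hs h).2 rfl
    rw [sub_sub_cancel, show (4 : ℝ) / 2 ^ 2 = 1 by norm_num] at h
    have h2 := integral_weighted_gradient_mono
      (show 2 - (n : ℝ) ≤ 2 - ((n : ℝ) - 2) by linarith) hψ hK hs
    simp only [Real.rpow_two, sq_abs, div_self (two_ne_zero' ℝ), Real.rpow_one]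
    rw [neg_sub] at h
    linarith
  · obtain ⟨C, hC, hsob⟩ := sobolev_ball hn hq hq'
    have hq0 : 0 < q := by linarith
    set β := ((n : ℝ) - 2) / q with hβ
    have hβq : β * q = (n : ℝ) - 2 := by rw [hβ]; field_simp
    have hβ0 : 0 < β := div_pos (by linarith) hq0
    have hβ2 : 2 * β < (n : ℝ) - 2 := by rw [← hβq, mul_comm]; gcongr
    have hσ : 2 * β + 2 < n := by linarith
    set H := 2 + 2 * β ^ 2 * (4 / ((n : ℝ) - (2 * β + 2)) ^ 2)
    have hH : 0 < H := by positivity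
    refine ⟨C * H + 1, by positivity, fun ψ hψ hK hs => ?_⟩
    have h0 : (0 : 𝔼) ∉ tsupport ψ := fun h => (hs h).2 rfl
    have hψ2 : ∀ x ∉ tsupport ψ, ψ x ^ 2 = 0 := fun x hx => by
      simp [image_eq_zero_of_notMem_tsupport hx]
    have hg2 : ∀ x ∉ tsupport ψ, ‖gradient ψ x‖ ^ 2 = 0 := fun x hx => by
      simp [gradient_eq_zero_of_notMem_tsupport hx]
    have hf := contDiff_norm_rpow_mul (-β) hψ h0
    have hfs : tsupport (fun x => ‖x‖ ^ (-β) * ψ x) ⊆ tsupport ψ := tsupport_mul_subset_right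
    have hfg : ∀ x ∉ tsupport ψ, gradient (fun x => ‖x‖ ^ (-β) * ψ x) x = 0 := fun x hx =>
      gradient_eq_zero_of_notMem_tsupport fun h => hx (hfs h)
    have h1 := hsob _ hf (hK.of_isClosed_subset (isClosed_tsupport _) hfs)
      fun x hx => (hs (hfs (subset_tsupport _ hx))).1
    have e1 : ∀ x : 𝔼, |‖x‖ ^ (-β) * ψ x| ^ q = ‖x‖ ^ (2 - (n : ℝ)) * |ψ x| ^ q := fun x => by
      rw [abs_mul, abs_of_nonneg (by positivity), Real.mul_rpow (by positivity) (abs_nonneg _),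
        ← Real.rpow_mul (norm_nonneg x), neg_mul, hβq, neg_sub]
    simp only [e1] at h1
    have i1 : Integrable fun x => 2 * (‖x‖ ^ (-(2 * β)) * ‖gradient ψ x‖ ^ 2) :=
      (integrable_norm_rpow_mul hK h0 _ ((continuous_gradient hψ).norm.pow 2) hg2).const_mul _
    have i2 : Integrable fun x => 2 * β ^ 2 * (‖x‖ ^ (-(2 * β + 2)) * ψ x ^ 2) :=
      (integrable_norm_rpow_mul hK h0 _ (hψ.continuous.pow 2) hψ2).const_mul _
    have h2 : ∫ x, ‖gradient (fun x => ‖x‖ ^ (-β) * ψ x) x‖ ^ 2 ≤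
        2 * (∫ x, ‖x‖ ^ (-(2 * β)) * ‖gradient ψ x‖ ^ 2) +
          2 * β ^ 2 * ∫ x, ‖x‖ ^ (-(2 * β + 2)) * ψ x ^ 2 := by
      rw [← integral_const_mul, ← integral_const_mul,
        ← integral_add i1 i2]
      refine integral_mono (integrable_of_continuousOn_of_eq_zero hK
        ((continuous_gradient hf).norm.pow 2).continuousOn fun x hx => by simp [hfg x hx])
        (i1.add i2) fun x => ?_
      by_cases hx : x ∈ tsupport ψ
      · exact norm_sq_gradient_norm_rpow_mul_le β hψ (ne_of_mem_of_not_mem hx h0)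
      · simp [hfg x hx, hψ2 x hx, hg2 x hx]
    have h3 := hardy hσ hψ hK h0
    rw [show 2 - (2 * β + 2) = -(2 * β) by ring] at h3
    have h4 := integral_weighted_gradient_mono
      (show 2 - (n : ℝ) ≤ -(2 * β) by linarith) hψ hK hs
    have h5 := mul_le_mul_of_nonneg_left h3 (show 0 ≤ 2 * β ^ 2 by positivity)
    have h6 := mul_le_mul_of_nonneg_left h4 hH.le
    have h7 : 0 ≤ ∫ x, ‖x‖ ^ (2 - (n : ℝ)) * ‖gradient ψ x‖ ^ 2 :=
      integral_nonneg fun x => by positivity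
    have h8 : ∫ x, ‖gradient (fun x => ‖x‖ ^ (-β) * ψ x) x‖ ^ 2 ≤
        H * ∫ x, ‖x‖ ^ (2 - (n : ℝ)) * ‖gradient ψ x‖ ^ 2 := by
      refine (h2.trans ?_).trans h6
      simp only [H]
      linarith
    have h9 := mul_le_mul_of_nonneg_left h8 hC
    linarith

end WeightedSobolev

lemma dH_rpow_mul_abs_rpow_le {n : ℕ} (hn : 2 ≤ n) {α q : ℝ} {x : EuclideanSpace ℝ (Fin n)}
    (hx : x ∈ Metric.ball (0 : EuclideanSpace ℝ (Fin n)) 1 \ {0}) (u : ℝ) :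
    dH x ^ ((((n : ℝ) - 2) * (q - 2) + (α - 2) * q) / 2) * |u| ^ q ≤
      ‖x‖ ^ (2 - (n : ℝ)) * |dH x ^ (((n : ℝ) + α - 4) / 2) * u| ^ q := by
  obtain ⟨h0, h1⟩ := norm_pos_and_lt_one hx
  have hd := dH_pos hx
  have hn' : (2 : ℝ) ≤ n := by exact_mod_cast hn
  have hr : ‖x‖ ≤ dH x := by
    linarith [two_mul_le_distProfile h0 h1, show distProfile ‖x‖ = dH x from rfl]
  rw [abs_mul, abs_of_pos (Real.rpow_pos_of_pos hd _),
    Real.mul_rpow (Real.rpow_pos_of_pos hd _).le (abs_nonneg u), ← Real.rpow_mul hd.le,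
    show (((n : ℝ) - 2) * (q - 2) + (α - 2) * q) / 2 =
      2 - (n : ℝ) + ((n : ℝ) + α - 4) / 2 * q by ring, Real.rpow_add hd, mul_assoc]
  exact mul_le_mul_of_nonneg_right (Real.rpow_le_rpow_of_nonpos h0 hr (by linarith))
    (by positivity)

/-- Improved Rellich–Sobolev type inequality on ℍⁿ (Corollary 3.3). -/
theorem rellich_sobolev_hyperbolic {n : ℕ} (hn : 2 < n)
    (α : ℝ) (hα₁ : (8 - (n : ℝ)) / 3 < α) (hα₂ : α < 2) :
    ∃ ε > (0 : ℝ), ∀ q : ℝ, 2 ≤ q → q ≤ 2 * n / ((n : ℝ) - 1) + 2 * ε →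
      ∃ K > (0 : ℝ), ∀ φ : EuclideanSpace ℝ (Fin n) → ℝ,
        ContDiff ℝ (⊤ : ℕ∞) φ → HasCompactSupport φ →
        tsupport φ ⊆ Metric.ball (0 : EuclideanSpace ℝ (Fin n)) 1 \ {0} →
        ((n : ℝ) - α) ^ 2 / 4 *
              (∫ x in Metric.ball (0 : EuclideanSpace ℝ (Fin n)) 1,
                dH x ^ (α - 2) * ‖gradient φ x‖ ^ 2 * lam x ^ ((n : ℝ) - 2)) +
            K * (∫ x in Metric.ball (0 : EuclideanSpace ℝ (Fin n)) 1,
                dH x ^ ((((n : ℝ) - 2) * (q - 2) + (α - 2) * q) / 2) * |φ x| ^ q) ^ (2 / q) ≤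
          ∫ x in Metric.ball (0 : EuclideanSpace ℝ (Fin n)) 1,
            dH x ^ α * lam x ^ (-(n : ℝ)) *
              (dvg (fun y => lam y ^ ((n : ℝ) - 2) • gradient φ y) x) ^ 2 := by
  have hn' : (3 : ℝ) ≤ n := by exact_mod_cast hn
  refine ⟨n / (((n : ℝ) - 1) * ((n : ℝ) - 2)),
    div_pos (by linarith) (mul_pos (by linarith) (by linarith)), fun q hq hq' => ?_⟩
  have hq0 : 0 < q := by linarith
  have hn1 : (n : ℝ) - 1 ≠ 0 := by linarith
  have hn2 : 0 < (n : ℝ) - 2 := by linarith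
  have hq2 : 1 / 2 - 1 / (n : ℝ) ≤ 1 / q := by
    have h1 : 2 * n / ((n : ℝ) - 1) + 2 * (n / (((n : ℝ) - 1) * ((n : ℝ) - 2))) =
        2 * n / ((n : ℝ) - 2) := by
      field_simp
      ring
    rw [h1, le_div_iff₀ hn2] at hq'
    rw [le_div_iff₀ hq0]
    have h2 : (1 / 2 - 1 / (n : ℝ)) * q = q * ((n : ℝ) - 2) / (2 * n) := by field_simp
    rw [h2, div_le_one (by positivity)]
    exact hq'
  obtain ⟨C, hC, hsob⟩ := weighted_sobolev (n := n) hn hq hq2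
  set a := ((n : ℝ) + α - 4) / 2 with ha
  set c := ((n : ℝ) - α) / 2 with hc
  have ha0 : 0 < a := by rw [ha]; linarith
  have hc0 : 0 < c := by rw [hc]; linarith
  set κ := min (a ^ 2) (2 * c * a - c ^ 2) with hκ
  have hκ0 : 0 < κ := lt_min (by positivity) (by
    have : 0 < c * (2 * a - c) := mul_pos hc0 (by rw [ha, hc]; linarith)
    linarith)
  refine ⟨κ / C, div_pos hκ0 hC, fun φ hφ hK hs => ?_⟩
  have h1 := rellich_remainder hn hα₂ ha hc ha0 hκ0.le (min_le_left _ _) (min_le_right _ _)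
    hφ hK hs
  set ψ := fun y => dH y ^ a * φ y with hψ
  have hψc : ContDiff ℝ 1 ψ := contDiff_dH_rpow_mul a hφ hs
  have hψs : tsupport ψ ⊆ tsupport φ := tsupport_mul_subset_right
  have hψK : HasCompactSupport ψ := hK.of_isClosed_subset (isClosed_tsupport _) hψs
  have h2 := hsob ψ hψc hψK (hψs.trans hs)
  have hball : ∀ {x : EuclideanSpace ℝ (Fin n)}, x ∉ Metric.ball 0 1 → x ∉ tsupport φ :=
    fun hx h => hx (hs h).1
  have hφ0 : ∀ x ∉ tsupport φ, φ x = 0 := fun x hx => image_eq_zero_of_notMem_tsupport hx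
  have e1 : ∫ x in Metric.ball (0 : EuclideanSpace ℝ (Fin n)) 1,
      ‖x‖ ^ (2 - (n : ℝ)) * ‖gradient ψ x‖ ^ 2 =
      ∫ x, ‖x‖ ^ (2 - (n : ℝ)) * ‖gradient ψ x‖ ^ 2 :=
    setIntegral_eq_integral_of_forall_compl_eq_zero fun x hx => by
      simp [gradient_eq_zero_of_notMem_tsupport fun h => hball hx (hψs h)]
  have i1 : Integrable fun x : EuclideanSpace ℝ (Fin n) => ‖x‖ ^ (2 - (n : ℝ)) * |ψ x| ^ q :=
    integrable_norm_rpow_mul hK (fun h => (hs h).2 rfl) _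
      (hψc.continuous.abs.rpow_const fun x => Or.inr hq0.le)
      fun x hx => by simp [hψ, hφ0 x hx, Real.zero_rpow hq0.ne']
  have h3 : (∫ x in Metric.ball (0 : EuclideanSpace ℝ (Fin n)) 1,
      dH x ^ ((((n : ℝ) - 2) * (q - 2) + (α - 2) * q) / 2) * |φ x| ^ q) ≤
      ∫ x, ‖x‖ ^ (2 - (n : ℝ)) * |ψ x| ^ q := by
    rw [setIntegral_eq_integral_of_forall_compl_eq_zero fun x hx => by
      simp [hφ0 x (hball hx), Real.zero_rpow hq0.ne']]
    refine integral_mono_of_nonneg (.of_forall fun x => ?_) i1 (.of_forall fun x => ?_)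
    all_goals
      by_cases hx : x ∈ tsupport φ
      · first
        | exact dH_rpow_mul_abs_rpow_le hn.le (hs hx) (φ x)
        | exact mul_nonneg (Real.rpow_nonneg (dH_pos (hs hx)).le _) (by positivity)
      · simp [hψ, hφ0 x hx, Real.zero_rpow hq0.ne']
  have h4 : 0 ≤ ∫ x in Metric.ball (0 : EuclideanSpace ℝ (Fin n)) 1,
      dH x ^ ((((n : ℝ) - 2) * (q - 2) + (α - 2) * q) / 2) * |φ x| ^ q := by
    refine integral_nonneg fun x => ?_
    by_cases hx : x ∈ tsupport φ
    · exact mul_nonneg (Real.rpow_nonneg (dH_pos (hs hx)).le _) (by positivity)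
    · simp [hφ0 x hx, Real.zero_rpow hq0.ne']
  have h5 := (Real.rpow_le_rpow h4 h3 (by positivity : 0 ≤ 2 / q)).trans h2
  have h6 := mul_le_mul_of_nonneg_left h5 (div_pos hκ0 hC).le
  rw [e1] at h1
  rw [← mul_assoc, div_mul_cancel₀ _ hC.ne'] at h6
  rw [show ((n : ℝ) - α) ^ 2 / 4 = c ^ 2 by rw [hc]; ring]
  linarith
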